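/- arXiv:1112.4250 — 2 statements merged into one kernel-verified Lean document; each statement's English description precedes it below -/
import Mathlib

section
/- If 𝒜 = (Q, 1, 1, F) is a semi-flower automaton with a unique bpi, then rk(L(𝒜)) ≤ |F| − |Q| + 1. Moreover, if 𝒜 is deterministic, then rk(L(𝒜)) = |F| − |Q| + 1. -/
open Pointwise

/-- A finite automaton over an alphabet `A`, given by its finite set of states,
sets of initial and final states, and set of transitions. -/
structure FA (Q A : Type*) where
  states : Finset Q
  I : Finset Q
  T : Finset Q
  F : Finset (Q × A × Q)
  I_sub : I ⊆ states
  T_sub : T ⊆ states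
  F_src : ∀ t ∈ F, t.1 ∈ states
  F_tgt : ∀ t ∈ F, t.2.2 ∈ states

namespace FA

variable {Q Q' A : Type*}

/-- `M.IsPath p ts q` : `ts` is a (possibly null) path of consecutive transitions
from `p` to `q` in `M`. -/
def IsPath (M : FA Q A) : Q → List (Q × A × Q) → Q → Prop
  | p, [], q => p = q
  | p, t :: ts, q => t ∈ M.F ∧ t.1 = p ∧ M.IsPath t.2.2 ts q

/-- The label of a path, as an element of the free monoid `A*`. -/
def label (ts : List (Q × A × Q)) : FreeMonoid A :=
  FreeMonoid.ofList (ts.map fun t => t.2.1)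

/-- The states visited by a path starting at `p`. -/
def statesOf (p : Q) (ts : List (Q × A × Q)) : List Q :=
  p :: ts.map fun t => t.2.2

/-- A state is accessible if some path leads from an initial state to it. -/
def Accessible (M : FA Q A) (q : Q) : Prop := ∃ i ∈ M.I, ∃ ts, M.IsPath i ts q

/-- A state is coaccessible if some path leads from it to a final state. -/
def Coaccessible (M : FA Q A) (q : Q) : Prop := ∃ t ∈ M.T, ∃ ts, M.IsPath q ts t

/-- An automaton is trim if every state is accessible and coaccessible. -/
def Trim (M : FA Q A) : Prop := ∀ q ∈ M.states, M.Accessible q ∧ M.Coaccessible q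

/-- Deterministic: a unique initial state, and at most one transition per state and letter. -/
def Deterministic (M : FA Q A) : Prop :=
  M.I.card = 1 ∧ ∀ p a q q', (p, a, q) ∈ M.F → (p, a, q') ∈ M.F → q = q'

/-- The language accepted by `M`: labels of paths from an initial to a final state. -/
def lang (M : FA Q A) : Set (FreeMonoid A) :=
  { w | ∃ i ∈ M.I, ∃ t ∈ M.T, ∃ ts, M.IsPath i ts t ∧ label ts = w }

/-- A semi-flower automaton: trim, with unique initial state equal to the unique
final state `one`, and every cycle (non-null path from a state to itself) visits `one`. -/
structure IsSemiFlower (M : FA Q A) (one : Q) : Prop where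
  mem : one ∈ M.states
  init : M.I = {one}
  final : M.T = {one}
  trim : M.Trim
  cyc : ∀ q ts, ts ≠ [] → M.IsPath q ts q → one ∈ statesOf q ts

/-- A cycle simple in `one` : a cycle from `one` to `one` with no intermediate visit to `one`. -/
def SimpleCycleIn (M : FA Q A) (one : Q) (ts : List (Q × A × Q)) : Prop :=
  ts ≠ [] ∧ M.IsPath one ts one ∧ ∀ t ∈ ts.dropLast, t.2.2 ≠ one

/-- `Y_𝒜` : the set of labels of cycles simple in `one`. -/
def Y (M : FA Q A) (one : Q) : Set (FreeMonoid A) :=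
  { w | ∃ ts, M.SimpleCycleIn one ts ∧ label ts = w }

/-- `C_𝒜` : the set of cycles simple in `one`. -/
def C (M : FA Q A) (one : Q) : Set (List (Q × A × Q)) :=
  { ts | M.SimpleCycleIn one ts }

/-- The distance from `p` to `q` : the length of a shortest path from `p` to `q`. -/
noncomputable def dist (M : FA Q A) (p q : Q) : ℕ :=
  sInf { n | ∃ ts, M.IsPath p ts q ∧ ts.length = n }

section Deg

variable [DecidableEq Q] [DecidableEq A]

/-- The indegree of a state: the number of transitions ending at it. -/
def indeg (M : FA Q A) (q : Q) : ℕ := (M.F.filter fun t => t.2.2 = q).card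

/-- The outdegree of a state: the number of transitions starting at it. -/
def outdeg (M : FA Q A) (q : Q) : ℕ := (M.F.filter fun t => t.1 = q).card

/-- A branch point going in (bpi): a state of indegree at least 2. -/
def IsBpi (M : FA Q A) (q : Q) : Prop := 2 ≤ M.indeg q

/-- `BPO_i(𝒜)` : the set of states of outdegree exactly `i`. -/
def BPO (M : FA Q A) (i : ℕ) : Finset Q := M.states.filter fun q => M.outdeg q = i

end Deg

/-- The product automaton. -/
def prod [DecidableEq Q] [DecidableEq Q'] [DecidableEq A]
    (M : FA Q A) (N : FA Q' A) : FA (Q × Q') A where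
  states := M.states ×ˢ N.states
  I := M.I ×ˢ N.I
  T := M.T ×ˢ N.T
  F := ((M.F ×ˢ N.F).filter fun t => t.1.2.1 = t.2.2.1).image
        fun t => ((t.1.1, t.2.1), t.1.2.1, (t.1.2.2, t.2.2.2))
  I_sub := Finset.product_subset_product M.I_sub N.I_sub
  T_sub := Finset.product_subset_product M.T_sub N.T_sub
  F_src := by
    intro t ht
    simp only [Finset.mem_image, Finset.mem_filter, Finset.mem_product] at ht
    obtain ⟨s, ⟨⟨h1, h2⟩, -⟩, rfl⟩ := ht
    exact Finset.mem_product.mpr ⟨M.F_src _ h1, N.F_src _ h2⟩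
  F_tgt := by
    intro t ht
    simp only [Finset.mem_image, Finset.mem_filter, Finset.mem_product] at ht
    obtain ⟨s, ⟨⟨h1, h2⟩, -⟩, rfl⟩ := ht
    exact Finset.mem_product.mpr ⟨M.F_tgt _ h1, N.F_tgt _ h2⟩

open Classical in
/-- The trim part of an automaton: the restriction to states that are both
accessible and coaccessible. -/
noncomputable def trimPart (M : FA Q A) : FA Q A where
  states := M.states.filter fun q => M.Accessible q ∧ M.Coaccessible q
  I := M.I.filter fun q => M.Accessible q ∧ M.Coaccessible q
  T := M.T.filter fun q => M.Accessible q ∧ M.Coaccessible q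
  F := M.F.filter fun t => (M.Accessible t.1 ∧ M.Coaccessible t.1) ∧
        (M.Accessible t.2.2 ∧ M.Coaccessible t.2.2)
  I_sub := by
    intro q hq
    simp only [Finset.mem_filter] at *
    exact ⟨M.I_sub hq.1, hq.2⟩
  T_sub := by
    intro q hq
    simp only [Finset.mem_filter] at *
    exact ⟨M.T_sub hq.1, hq.2⟩
  F_src := by
    intro t ht
    simp only [Finset.mem_filter] at *
    exact ⟨M.F_src _ ht.1, ht.2.1⟩
  F_tgt := by
    intro t ht
    simp only [Finset.mem_filter] at *
    exact ⟨M.F_tgt _ ht.1, ht.2.2⟩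

end FA

/-- The minimal generating set of a submonoid `L` of a free monoid:
`(L ∖ {1}) ∖ (L ∖ {1})·(L ∖ {1})`. -/
def minGen {A : Type*} (L : Set (FreeMonoid A)) : Set (FreeMonoid A) :=
  (L \ {1}) \ ((L \ {1}) * (L \ {1}))

/-- The rank of a submonoid of a free monoid: the cardinality of its (unique)
minimal set of generators. -/
noncomputable def rkL {A : Type*} (L : Set (FreeMonoid A)) : ℕ := (minGen L).ncard

/-- The reduced rank `max (0, rk - 1)` of a submonoid of a free monoid. -/
noncomputable def rrk {A : Type*} (L : Set (FreeMonoid A)) : ℕ := rkL L - 1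

namespace FA

variable {Q A : Type*} {M : FA Q A} {one b : Q}

theorem isPath_append {l l' : List (Q × A × Q)} {p q : Q} :
    M.IsPath p (l ++ l') q ↔ ∃ r, M.IsPath p l r ∧ M.IsPath r l' q := by
  induction l generalizing p with
  | nil => simp [IsPath]
  | cons t l ih =>
    simp only [List.cons_append, IsPath, ih]
    tauto

theorem isPath_append_cons {l l' : List (Q × A × Q)} {t : Q × A × Q} {p q : Q} :
    M.IsPath p (l ++ t :: l') q ↔ t ∈ M.F ∧ M.IsPath p l t.1 ∧ M.IsPath t.2.2 l' q := by
  rw [isPath_append]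
  constructor
  · rintro ⟨r, h, ht, rfl, h'⟩
    exact ⟨ht, h, h'⟩
  · rintro ⟨ht, h, h'⟩
    exact ⟨_, h, ht, rfl, h'⟩

theorem IsPath.mem_F {l : List (Q × A × Q)} {t : Q × A × Q} {p q : Q}
    (h : M.IsPath p l q) (ht : t ∈ l) : t ∈ M.F := by
  obtain ⟨x, y, rfl⟩ := List.append_of_mem ht
  exact (isPath_append_cons.1 h).1

/-- A nonempty path ends with a transition into its target. -/
theorem IsPath.exists_tgt_eq {l : List (Q × A × Q)} {p q : Q}
    (h : M.IsPath p l q) (hl : l ≠ []) : ∃ t ∈ l, t.2.2 = q := by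
  rcases List.eq_nil_or_concat l with rfl | ⟨l, t, rfl⟩
  · exact absurd rfl hl
  · rw [List.concat_eq_append] at *
    exact ⟨t, by simp, (isPath_append_cons.1 h).2.2⟩

theorem label_append (l l' : List (Q × A × Q)) : label (l ++ l') = label l * label l' := by
  simp [label]

theorem label_eq_one {l : List (Q × A × Q)} : label l = 1 ↔ l = [] := by
  constructor
  · intro h
    exact List.map_eq_nil_iff.1 (FreeMonoid.ofList.injective h)
  · rintro rfl
    rfl

/-- In a deterministic automaton a path is determined by its origin and its label. -/
theorem Deterministic.path_ext (hM : M.Deterministic) {l l' : List (Q × A × Q)} {p q q' : Q}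
    (h : M.IsPath p l q) (h' : M.IsPath p l' q') (hl : label l = label l') : l = l' := by
  replace hl : l.map (fun t => t.2.1) = l'.map (fun t => t.2.1) := FreeMonoid.ofList.injective hl
  induction l generalizing p l' with
  | nil => exact (List.map_eq_nil_iff.1 hl.symm).symm
  | cons t l ih =>
    cases l' with
    | nil => simp at hl
    | cons t' l' =>
      obtain ⟨p₁, a, q₁⟩ := t
      obtain ⟨p₂, a', q₂⟩ := t'
      simp only [List.map_cons, List.cons.injEq] at hl
      obtain ⟨rfl, hl⟩ := hl
      obtain ⟨ht, rfl, h⟩ := h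
      obtain ⟨ht', hp, h'⟩ := h'
      simp only at hp h h'
      subst hp
      obtain rfl := hM.2 _ _ _ _ ht ht'
      rw [ih h h' hl]

/-- If every state other than `b` has at most one incoming transition, then of two paths with
the same end, one of which does not enter `b`, one is a suffix of the other. -/
theorem isSuffix_or_isSuffix
    (huniq : ∀ t ∈ M.F, ∀ t' ∈ M.F, t.2.2 = t'.2.2 → t.2.2 ≠ b → t = t')
    {l l' : List (Q × A × Q)} {p p' q : Q} (h : M.IsPath p l q) (h' : M.IsPath p' l' q)
    (hb : ∀ t ∈ l, t.2.2 ≠ b) : l <:+ l' ∨ l' <:+ l := by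
  induction l using List.reverseRecOn generalizing q l' with
  | nil => exact .inl (List.nil_suffix)
  | append_singleton l t ih =>
    rcases List.eq_nil_or_concat l' with rfl | ⟨l', t', rfl⟩
    · exact .inr (List.nil_suffix)
    rw [List.concat_eq_append] at *
    obtain ⟨ht, h, hq⟩ := isPath_append_cons.1 h
    obtain ⟨ht', h', hq'⟩ := isPath_append_cons.1 h'
    obtain rfl := huniq t ht t' ht' (hq.trans hq'.symm) (hb t (by simp))
    rcases ih h h' (fun s hs => hb s (by simp [hs])) with ⟨z, rfl⟩ | ⟨z, rfl⟩
    · exact .inl ⟨z, by simp⟩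
    · exact .inr ⟨z, by simp⟩

theorem IsPath.src_eq {l : List (Q × A × Q)} {p p' q : Q} (h : M.IsPath p l q)
    (h' : M.IsPath p' l q) : p = p' := by
  cases l with
  | nil => exact Eq.trans h (Eq.symm h')
  | cons t l => exact h.2.1.symm.trans h'.2.1

theorem IsPath.eq_of_isSuffix {l l' : List (Q × A × Q)} {p q : Q} (h : M.IsPath p l q)
    (h' : M.IsPath p l' q) (hsuff : l <:+ l') (hp : ∀ t ∈ l', t.2.2 ≠ p) : l = l' := by
  obtain ⟨z, rfl⟩ := hsuff
  obtain ⟨r, hz, hr⟩ := isPath_append.1 h'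
  obtain rfl := hr.src_eq h
  by_cases hz0 : z = []
  · simp [hz0]
  · obtain ⟨t, ht, htr⟩ := hz.exists_tgt_eq hz0
    exact absurd htr (hp t (by simp [ht]))

theorem path_eq (huniq : ∀ t ∈ M.F, ∀ t' ∈ M.F, t.2.2 = t'.2.2 → t.2.2 ≠ b → t = t')
    {l l' : List (Q × A × Q)} {p q : Q} (h : M.IsPath p l q) (h' : M.IsPath p l' q)
    (hb : ∀ t ∈ l, t.2.2 ≠ b) (hp : ∀ t ∈ l, t.2.2 ≠ p) (hp' : ∀ t ∈ l', t.2.2 ≠ p) :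
    l = l' := by
  rcases isSuffix_or_isSuffix huniq h h' hb with hs | hs
  · exact h.eq_of_isSuffix h' hs hp'
  · exact (h'.eq_of_isSuffix h hs hp).symm

/-- A nonempty closed path at `one` is a simple cycle or a product of two such paths. -/
theorem exists_split {ts : List (Q × A × Q)} (hne : ts ≠ []) (h : M.IsPath one ts one)
    (hs : ¬ M.SimpleCycleIn one ts) :
    ∃ u v, u ≠ [] ∧ v ≠ [] ∧ M.IsPath one u one ∧ M.IsPath one v one ∧ ts = u ++ v := by
  have : ∃ t ∈ ts.dropLast, t.2.2 = one := by
    by_contra! hc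
    exact hs ⟨hne, h, hc⟩
  obtain ⟨t, ht, rfl⟩ := this
  obtain ⟨x, y, hxy⟩ := List.append_of_mem ht
  have hts := List.dropLast_append_getLast hne
  rw [hxy] at hts
  refine ⟨x ++ [t], y ++ [ts.getLast hne], by simp, by simp, ?_, ?_, hts.symm.trans (by simp)⟩
  all_goals
    rw [← hts, List.append_assoc, List.cons_append, isPath_append_cons] at h
  · exact isPath_append_cons.2 ⟨h.1, h.2.1, rfl⟩
  · exact h.2.2

theorem SimpleCycleIn.ne_one {x y : List (Q × A × Q)} (h : M.SimpleCycleIn one (x ++ y))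
    (hy : y ≠ []) : ∀ t ∈ x, t.2.2 ≠ one := by
  intro t ht
  exact h.2.2 t (by rw [List.dropLast_append_of_ne_nil hy]; simp [ht])

/-- Every transition of a closed path at `one` lies on a simple cycle. -/
theorem exists_simpleCycleIn_mem {ts : List (Q × A × Q)} {e : Q × A × Q}
    (h : M.IsPath one ts one) (he : e ∈ ts) : ∃ c, M.SimpleCycleIn one c ∧ e ∈ c := by
  induction hn : ts.length using Nat.strong_induction_on generalizing ts with
  | _ n ih =>
    by_cases hs : M.SimpleCycleIn one ts
    · exact ⟨ts, hs, he⟩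
    obtain ⟨u, v, hu, hv, hpu, hpv, rfl⟩ := exists_split (List.ne_nil_of_mem he) h hs
    have hu := List.length_pos_iff.2 hu
    have hv := List.length_pos_iff.2 hv
    rw [List.length_append] at hn
    rcases List.mem_append.1 he with he | he
    · exact ih _ (by omega) hpu he rfl
    · exact ih _ (by omega) hpv he rfl

theorem IsSemiFlower.mem_lang (hsf : M.IsSemiFlower one) {w : FreeMonoid A} :
    w ∈ M.lang ↔ ∃ ts, M.IsPath one ts one ∧ label ts = w := by
  simp [lang, hsf.init, hsf.final]

theorem IsSemiFlower.exists_path_from (hsf : M.IsSemiFlower one) {q : Q} (hq : q ∈ M.states) :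
    ∃ ts, M.IsPath one ts q := by
  simpa [Accessible, hsf.init] using (hsf.trim q hq).1

theorem IsSemiFlower.exists_path_to (hsf : M.IsSemiFlower one) {q : Q} (hq : q ∈ M.states) :
    ∃ ts, M.IsPath q ts one := by
  simpa [Coaccessible, hsf.final] using (hsf.trim q hq).2

theorem IsSemiFlower.minGen_subset (hsf : M.IsSemiFlower one) :
    minGen M.lang ⊆ label '' M.C one := by
  rintro w ⟨⟨hw, hw1⟩, hprod⟩
  obtain ⟨ts, hp, rfl⟩ := hsf.mem_lang.1 hw
  refine ⟨ts, ?_, rfl⟩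
  by_contra hs
  obtain ⟨u, v, hu, hv, hpu, hpv, rfl⟩ := exists_split (fun h => hw1 (label_eq_one.2 h)) hp hs
  exact hprod ⟨label u, ⟨hsf.mem_lang.2 ⟨u, hpu, rfl⟩, fun h => hu (label_eq_one.1 h)⟩,
    label v, ⟨hsf.mem_lang.2 ⟨v, hpv, rfl⟩, fun h => hv (label_eq_one.1 h)⟩,
    (label_append u v).symm⟩

theorem IsSemiFlower.subset_minGen (hsf : M.IsSemiFlower one) (hM : M.Deterministic) :
    label '' M.C one ⊆ minGen M.lang := by
  rintro _ ⟨ts, hs, rfl⟩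
  refine ⟨⟨hsf.mem_lang.2 ⟨ts, hs.2.1, rfl⟩, fun h => hs.1 (label_eq_one.1 h)⟩, ?_⟩
  rintro ⟨u, ⟨hu, hu1⟩, v, ⟨hv, hv1⟩, huv⟩
  obtain ⟨x, hx, rfl⟩ := hsf.mem_lang.1 hu
  obtain ⟨y, hy, rfl⟩ := hsf.mem_lang.1 hv
  obtain rfl := hM.path_ext hs.2.1 (isPath_append.2 ⟨_, hx, hy⟩)
    (huv.symm.trans (label_append x y).symm)
  obtain ⟨t, ht, hto⟩ := hx.exists_tgt_eq fun h => hu1 (label_eq_one.2 h)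
  exact hs.ne_one (fun h => hv1 (label_eq_one.2 h)) t ht hto

theorem Deterministic.injOn_label (hM : M.Deterministic) : Set.InjOn label (M.C one) :=
  fun _ h _ h' => hM.path_ext h.2.1 h'.2.1

/-- A simple cycle enters no state more than once. -/
theorem IsSemiFlower.tgt_ne_of_mem (hsf : M.IsSemiFlower one) {x y : List (Q × A × Q)}
    {e : Q × A × Q} (hs : M.SimpleCycleIn one (x ++ e :: y)) : ∀ t ∈ y, t.2.2 ≠ e.2.2 := by
  intro t ht hte
  obtain ⟨y₁, y₂, rfl⟩ := List.append_of_mem ht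
  have hmem : ∀ s ∈ x ++ e :: y₁, s.2.2 ≠ one :=
    SimpleCycleIn.ne_one (y := t :: y₂) (by simpa using hs) (by simp)
  have hpath := (isPath_append_cons.1 (isPath_append_cons.1 hs.2.1).2.2)
  have hcyc : M.IsPath e.2.2 (y₁ ++ [t]) e.2.2 :=
    isPath_append_cons.2 ⟨hpath.1, hpath.2.1, hte⟩
  have := hsf.cyc _ _ (by simp) hcyc
  simp only [statesOf, List.mem_cons, List.mem_map, List.mem_append, List.not_mem_nil,
    or_false] at this
  have he := hmem e (by simp)
  rcases this with h | ⟨s, hs | rfl, h⟩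
  · exact he h.symm
  · exact hmem s (by simp [hs]) h
  · exact he (hte.symm.trans h)

theorem IsSemiFlower.tgt_ne_of_mem_left (hsf : M.IsSemiFlower one) {x y : List (Q × A × Q)}
    {e : Q × A × Q} (hs : M.SimpleCycleIn one (x ++ e :: y)) : ∀ t ∈ x, t.2.2 ≠ e.2.2 := by
  intro t ht
  obtain ⟨x₁, x₂, rfl⟩ := List.append_of_mem ht
  have hs : M.SimpleCycleIn one (x₁ ++ t :: (x₂ ++ e :: y)) := by simpa using hs
  exact (hsf.tgt_ne_of_mem hs e (by simp)).symm

theorem IsSemiFlower.eq_of_mem_of_tgt_eq (hsf : M.IsSemiFlower one) {ts : List (Q × A × Q)}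
    {e e' : Q × A × Q} (hs : M.SimpleCycleIn one ts) (he : e ∈ ts) (he' : e' ∈ ts)
    (h : e'.2.2 = e.2.2) : e' = e := by
  obtain ⟨x, y, rfl⟩ := List.append_of_mem he
  rcases List.mem_append.1 he' with hx | hx
  · exact absurd h (hsf.tgt_ne_of_mem_left hs e' hx)
  · rcases List.mem_cons.1 hx with rfl | hy
    · rfl
    · exact absurd h (hsf.tgt_ne_of_mem hs e' hy)

/-- Every simple cycle enters the unique bpi. -/
theorem IsSemiFlower.exists_mem_tgt_eq (hsf : M.IsSemiFlower one)
    (huniq : ∀ t ∈ M.F, ∀ t' ∈ M.F, t.2.2 = t'.2.2 → t.2.2 ≠ b → t = t') (hb : b ∈ M.states)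
    {ts : List (Q × A × Q)} (hs : M.SimpleCycleIn one ts) : ∃ t ∈ ts, t.2.2 = b := by
  by_contra! hc
  have hone : one ≠ b := by
    rintro rfl
    obtain ⟨t, ht, h⟩ := hs.2.1.exists_tgt_eq hs.1
    exact hc t ht h
  obtain ⟨l, hl⟩ := hsf.exists_path_to hb
  induction hn : l.length using Nat.strong_induction_on generalizing l with
  | _ n ih =>
    rcases isSuffix_or_isSuffix huniq hs.2.1 hl hc with ⟨z, rfl⟩ | ⟨z, rfl⟩
    · obtain ⟨r, hz, hr⟩ := isPath_append.1 hl
      obtain rfl := hr.src_eq hs.2.1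
      have hpos := List.length_pos_iff.2 hs.1
      rw [List.length_append] at hn
      exact ih _ (by omega) z hz rfl
    · obtain ⟨r, hz, hr⟩ := isPath_append.1 hs.2.1
      obtain rfl := hr.src_eq hl
      obtain ⟨t, ht, h⟩ := hz.exists_tgt_eq (by rintro rfl; exact hone hz)
      exact hc t (by simp [ht]) h

/-- A simple cycle is determined by the transition through which it enters the unique bpi. -/
theorem IsSemiFlower.eq_of_mem_of_mem (hsf : M.IsSemiFlower one)
    (huniq : ∀ t ∈ M.F, ∀ t' ∈ M.F, t.2.2 = t'.2.2 → t.2.2 ≠ b → t = t')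
    {c c' : List (Q × A × Q)} {e : Q × A × Q} (hc : M.SimpleCycleIn one c)
    (hc' : M.SimpleCycleIn one c') (he : e ∈ c) (he' : e ∈ c') (heb : e.2.2 = b) : c = c' := by
  obtain ⟨x, y, rfl⟩ := List.append_of_mem he
  obtain ⟨x', y', rfl⟩ := List.append_of_mem he'
  subst heb
  obtain ⟨-, hx, hy⟩ := isPath_append_cons.1 hc.2.1
  obtain ⟨-, hx', hy'⟩ := isPath_append_cons.1 hc'.2.1
  rw [path_eq huniq hx hx' (hsf.tgt_ne_of_mem_left hc) (hc.ne_one (by simp))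
      (hc'.ne_one (by simp)),
    path_eq huniq hy hy' (hsf.tgt_ne_of_mem hc) (hsf.tgt_ne_of_mem hc) (hsf.tgt_ne_of_mem hc')]

variable [DecidableEq Q]

theorem one_le_indeg {q : Q} : 1 ≤ M.indeg q ↔ ∃ t ∈ M.F, t.2.2 = q := by
  rw [indeg, Nat.one_le_iff_ne_zero, Finset.card_ne_zero]
  simp [Finset.Nonempty]

theorem IsSemiFlower.one_le_indeg (hsf : M.IsSemiFlower one) (hF : M.F.Nonempty) {q : Q}
    (hq : q ∈ M.states) : 1 ≤ M.indeg q := by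
  obtain ⟨e, he⟩ := hF
  obtain ⟨l, hl⟩ := hsf.exists_path_from (M.F_src e he)
  obtain ⟨l', hl'⟩ := hsf.exists_path_to (M.F_tgt e he)
  obtain ⟨m, hm⟩ := hsf.exists_path_from hq
  have hpath := isPath_append.2 ⟨_, isPath_append_cons.2 ⟨he, hl, hl'⟩, hm⟩
  obtain ⟨t, ht, htq⟩ := hpath.exists_tgt_eq (by simp)
  exact FA.one_le_indeg.2 ⟨t, hpath.mem_F ht, htq⟩

theorem eq_of_tgt_eq_of_indeg_le (hle : ∀ q, q ≠ b → M.indeg q ≤ 1) :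
    ∀ t ∈ M.F, ∀ t' ∈ M.F, t.2.2 = t'.2.2 → t.2.2 ≠ b → t = t' := by
  intro t ht t' ht' h hb
  exact Finset.card_le_one.1 (hle _ hb) t (by simp [ht]) t' (by simp [ht', h])

theorem IsSemiFlower.card_F (hsf : M.IsSemiFlower one) (hb : b ∈ M.states)
    (hF : M.F.Nonempty) (hle : ∀ q, q ≠ b → M.indeg q ≤ 1) :
    M.F.card + 1 = M.indeg b + M.states.card := by
  have hsum : M.F.card = ∑ q ∈ M.states, M.indeg q :=
    Finset.card_eq_sum_card_fiberwise fun t ht => M.F_tgt t ht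
  have hrest : ∑ q ∈ M.states.erase b, M.indeg q = ∑ q ∈ M.states.erase b, 1 :=
    Finset.sum_congr rfl fun q hq => le_antisymm (hle q (Finset.ne_of_mem_erase hq))
      (hsf.one_le_indeg hF (Finset.mem_of_mem_erase hq))
  rw [hsum, ← Finset.add_sum_erase _ _ hb, hrest, Finset.sum_const, smul_eq_mul, mul_one,
    add_assoc, Finset.card_erase_add_one hb]

/-- The simple cycles correspond to the transitions entering the unique bpi. -/
theorem IsSemiFlower.finite_C_and_ncard_C (hsf : M.IsSemiFlower one) (hb : b ∈ M.states)
    (hle : ∀ q, q ≠ b → M.indeg q ≤ 1) : (M.C one).Finite ∧ (M.C one).ncard = M.indeg b := by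
  have huniq := eq_of_tgt_eq_of_indeg_le hle
  have hex : ∀ e, ∃ c, e ∈ M.F → M.SimpleCycleIn one c ∧ e ∈ c := by
    intro e
    by_cases he : e ∈ M.F
    · obtain ⟨l, hl⟩ := hsf.exists_path_from (M.F_src e he)
      obtain ⟨l', hl'⟩ := hsf.exists_path_to (M.F_tgt e he)
      obtain ⟨c, hc⟩ := exists_simpleCycleIn_mem (e := e)
        (isPath_append_cons.2 ⟨he, hl, hl'⟩) (by simp)
      exact ⟨c, fun _ => hc⟩
    · exact ⟨[], fun h => absurd h he⟩
  choose g hg using hex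
  have himage : M.C one = g '' (M.F.filter fun t => t.2.2 = b : Finset _) := by
    ext c
    simp only [Set.mem_image, Finset.mem_coe, Finset.mem_filter]
    constructor
    · intro hc
      obtain ⟨e, hec, heb⟩ := hsf.exists_mem_tgt_eq huniq hb hc
      have he := hc.2.1.mem_F hec
      exact ⟨e, ⟨he, heb⟩, hsf.eq_of_mem_of_mem huniq (hg e he).1 hc (hg e he).2 hec heb⟩
    · rintro ⟨e, ⟨he, -⟩, rfl⟩
      exact (hg e he).1
  have hinj : Set.InjOn g (M.F.filter fun t => t.2.2 = b : Finset _) := by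
    intro e he e' he' h
    simp only [Finset.mem_coe, Finset.mem_filter] at he he'
    exact hsf.eq_of_mem_of_tgt_eq (hg e' he'.1).1 (hg e' he'.1).2 (h ▸ (hg e he.1).2)
      (he.2.trans he'.2.symm)
  rw [himage, hinj.ncard_image, Set.ncard_coe_finset]
  exact ⟨(Finset.finite_toSet _).image g, rfl⟩

end FA

/-- if `M` is a semi-flower automaton with a unique bpi, then
`rk(L(𝒜)) ≤ |F| - |Q| + 1`, with equality if `M` is deterministic. -/
theorem rank_semiFlower_unique_bpi
    {Q A : Type*} [DecidableEq Q] [DecidableEq A] [Fintype A]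
    (M : FA Q A) (one : Q) (hsf : M.IsSemiFlower one)
    (hbpi : ∃! b, M.IsBpi b) :
    (rkL M.lang : ℤ) ≤ (M.F.card : ℤ) - (M.states.card : ℤ) + 1 ∧
      (M.Deterministic → (rkL M.lang : ℤ) = (M.F.card : ℤ) - (M.states.card : ℤ) + 1) := by
  obtain ⟨b, hbpi, hunique⟩ := hbpi
  have hle : ∀ q, q ≠ b → M.indeg q ≤ 1 := by
    intro q hq
    by_contra! h
    exact hq (hunique q h)
  obtain ⟨e, he, rfl⟩ := FA.one_le_indeg.1 (one_le_two.trans hbpi)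
  have hb := M.F_tgt e he
  have hcard := hsf.card_F hb ⟨e, he⟩ hle
  obtain ⟨hfin, hC⟩ := hsf.finite_C_and_ncard_C hb hle
  constructor
  · have h₁ := Set.ncard_le_ncard hsf.minGen_subset (hfin.image _)
    have h₂ := Set.ncard_image_le (f := FA.label) hfin
    rw [rkL]
    omega
  · intro hM
    rw [rkL, hsf.minGen_subset.antisymm (hsf.subset_minGen hM),
      hM.injOn_label.ncard_image]
    omega
end

section
/- Let 𝒜 be a semi-flower automaton with exactly two bpi's p and q such that the distance from q to the initial-final state 1 is not more than the distance from p to 1. Then every cycle that visits p also visits q; moreover, if p ≠ q, the distance from p to 1 is strictly greater than the distance from q to 1. -/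
open Pointwise

namespace FA

variable {Q A : Type*} {M : FA Q A}

theorem isPath_append_s9 {a c : Q} {l₁ l₂ : List (Q × A × Q)} :
    M.IsPath a (l₁ ++ l₂) c ↔ ∃ b, M.IsPath a l₁ b ∧ M.IsPath b l₂ c := by
  induction l₁ generalizing a with
  | nil => simp [IsPath]
  | cons t l ih => simp [IsPath, ih, and_assoc]

theorem mem_statesOf {a x : Q} {ts : List (Q × A × Q)} :
    x ∈ statesOf a ts ↔ x = a ∨ ∃ t ∈ ts, t.2.2 = x := by
  simp [statesOf]

theorem statesOf_subset_append (a : Q) (l₁ l₂ : List (Q × A × Q)) :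
    statesOf a l₁ ⊆ statesOf a (l₁ ++ l₂) := by
  intro x hx
  rcases mem_statesOf.1 hx with h | ⟨t, ht, h⟩
  · exact mem_statesOf.2 (Or.inl h)
  · exact mem_statesOf.2 (Or.inr ⟨t, List.mem_append_left _ ht, h⟩)

theorem IsPath.end_mem_statesOf {a c : Q} {ts : List (Q × A × Q)} (h : M.IsPath a ts c) :
    c ∈ statesOf a ts := by
  induction ts generalizing a with
  | nil => exact mem_statesOf.2 (Or.inl h.symm)
  | cons t l ih => exact List.mem_cons_of_mem _ (ih h.2.2)

/-- A path visiting `x` can be cut at a visit to `x`. -/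
theorem IsPath.exists_append_of_mem_statesOf {a c x : Q} {ts : List (Q × A × Q)}
    (h : M.IsPath a ts c) (hx : x ∈ statesOf a ts) :
    ∃ l₁ l₂, ts = l₁ ++ l₂ ∧ M.IsPath a l₁ x ∧ M.IsPath x l₂ c := by
  rcases mem_statesOf.1 hx with rfl | ⟨t, ht, rfl⟩
  · exact ⟨[], ts, rfl, rfl, h⟩
  · obtain ⟨l₁, l₂, rfl⟩ := List.append_of_mem ht
    obtain ⟨b, h₁, h₂⟩ := isPath_append_s9.1 h
    exact ⟨l₁ ++ [t], l₂, by simp, isPath_append_s9.2 ⟨b, h₁, h₂.1, h₂.2.1, rfl⟩, h₂.2.2⟩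

/-- A path from `x` contains a path from `x` to the same end that never returns to `x`. -/
theorem IsPath.exists_subset_not_returning {x c : Q} {ts : List (Q × A × Q)}
    (h : M.IsPath x ts c) :
    ∃ l, l ⊆ ts ∧ M.IsPath x l c ∧ ∀ t ∈ l, t.2.2 ≠ x := by
  induction hn : ts.length using Nat.strong_induction_on generalizing ts with
  | _ n ih =>
    by_cases hret : ∃ t ∈ ts, t.2.2 = x
    · obtain ⟨t, ht, htx⟩ := hret
      obtain ⟨l₁, l₂, rfl⟩ := List.append_of_mem ht
      obtain ⟨b, -, -, -, h₂⟩ := isPath_append_s9.1 h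
      rw [htx] at h₂
      obtain ⟨l, hl, hpath, hne⟩ := ih l₂.length (by simp at hn; omega) h₂ rfl
      exact ⟨l, fun s hs => by simp [hl hs], hpath, hne⟩
    · push Not at hret
      exact ⟨ts, List.Subset.refl _, h, hret⟩

theorem IsPath.dist_le {a c : Q} {ts : List (Q × A × Q)} (h : M.IsPath a ts c) :
    M.dist a c ≤ ts.length :=
  Nat.sInf_le ⟨ts, h, rfl⟩

theorem IsPath.exists_length_eq_dist {a c : Q} {ts : List (Q × A × Q)} (h : M.IsPath a ts c) :
    ∃ l, M.IsPath a l c ∧ l.length = M.dist a c :=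
  Nat.sInf_mem (s := { n | ∃ ts, M.IsPath a ts c ∧ ts.length = n }) ⟨_, ts, h, rfl⟩

/-- The distance to the end drops strictly after the start of a shortest path. -/
theorem IsPath.dist_lt_of_mem {a c : Q} {ts : List (Q × A × Q)} (h : M.IsPath a ts c)
    (hlen : ts.length = M.dist a c) {t : Q × A × Q} (ht : t ∈ ts) :
    M.dist t.2.2 c < M.dist a c := by
  obtain ⟨l₁, l₂, rfl⟩ := List.append_of_mem ht
  obtain ⟨b, -, -, -, h₂⟩ := isPath_append_s9.1 h
  have := h₂.dist_le
  simp at hlen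
  omega

theorem IsSemiFlower.exists_isPath_one {one x : Q} (hsf : M.IsSemiFlower one)
    (hx : x ∈ M.states) : ∃ ts, M.IsPath x ts one := by
  obtain ⟨c, hc, ts, hts⟩ := (hsf.trim x hx).2
  rw [hsf.final, Finset.mem_singleton] at hc
  exact ⟨ts, hc ▸ hts⟩

section Deg

variable [DecidableEq Q]

theorem IsBpi.mem_states {x : Q} (hx : M.IsBpi x) : x ∈ M.states := by
  obtain ⟨t, ht⟩ := Finset.card_pos.1 (show 0 < M.indeg x from two_pos.trans_le hx)
  obtain ⟨htF, rfl⟩ := Finset.mem_filter.1 ht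
  exact M.F_tgt t htF

theorem eq_of_not_isBpi {t s : Q × A × Q} (ht : t ∈ M.F) (hs : s ∈ M.F)
    (hts : t.2.2 = s.2.2) (hb : ¬ M.IsBpi s.2.2) : t = s := by
  have hcard : M.indeg s.2.2 ≤ 1 := Nat.lt_succ_iff.1 (not_le.1 hb)
  exact Finset.card_le_one.1 hcard t (Finset.mem_filter.2 ⟨ht, hts⟩) s
    (Finset.mem_filter.2 ⟨hs, rfl⟩)

/-- Of two paths with the same end that enter no bpi, one visits the start of the other. -/
theorem IsPath.start_mem_statesOf_or {a b c : Q} {l₁ l₂ : List (Q × A × Q)}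
    (h₁ : M.IsPath a l₁ c) (h₂ : M.IsPath b l₂ c)
    (hb₁ : ∀ t ∈ l₁, ¬ M.IsBpi t.2.2) (hb₂ : ∀ t ∈ l₂, ¬ M.IsBpi t.2.2) :
    a ∈ statesOf b l₂ ∨ b ∈ statesOf a l₁ := by
  induction l₁ using List.reverseRecOn generalizing c l₂ with
  | nil => exact Or.inl (h₁ ▸ h₂.end_mem_statesOf)
  | append_singleton l₁ t ih =>
    rcases List.eq_nil_or_concat' l₂ with rfl | ⟨l₂, s, rfl⟩
    · exact Or.inr (h₂ ▸ h₁.end_mem_statesOf)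
    · obtain ⟨d, h₁, htF, rfl, htc⟩ := isPath_append_s9.1 h₁
      obtain ⟨e, h₂, hsF, rfl, hsc⟩ := isPath_append_s9.1 h₂
      obtain rfl : t = s := eq_of_not_isBpi htF hsF (htc.trans hsc.symm) (hb₂ s (by simp))
      rcases ih h₁ h₂ (fun u hu => hb₁ u (by simp [hu])) (fun u hu => hb₂ u (by simp [hu]))
        with h | h
      · exact Or.inl (statesOf_subset_append _ _ _ h)
      · exact Or.inr (statesOf_subset_append _ _ _ h)

/-- If `p` and `q` are the only bpi's and `q` is at most as far from `one` as `p`, then every path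
from `p` to `one` that does not return to `p` enters `q`. -/
theorem IsSemiFlower.exists_mem_target_eq {one p q : Q} (hsf : M.IsSemiFlower one)
    (hpq : p ≠ q) (hq : M.IsBpi q) (honly : ∀ r, M.IsBpi r → r = p ∨ r = q)
    (hdist : M.dist q one ≤ M.dist p one) {ts : List (Q × A × Q)} (h : M.IsPath p ts one)
    (hne : ∀ t ∈ ts, t.2.2 ≠ p) : ∃ t ∈ ts, t.2.2 = q := by
  by_contra! hnq
  obtain ⟨us, hus⟩ := hsf.exists_isPath_one hq.mem_states
  obtain ⟨l, hl, hlen⟩ := hus.exists_length_eq_dist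
  have hlp : ∀ t ∈ l, t.2.2 ≠ p := fun t ht htp =>
    absurd (htp ▸ hl.dist_lt_of_mem hlen ht) hdist.not_gt
  have hlq : ∀ t ∈ l, t.2.2 ≠ q := fun t ht htq =>
    lt_irrefl _ (htq ▸ hl.dist_lt_of_mem hlen ht)
  rcases h.start_mem_statesOf_or hl (fun t ht hb => (honly _ hb).elim (hne t ht) (hnq t ht))
    (fun t ht hb => (honly _ hb).elim (hlp t ht) (hlq t ht)) with hv | hv
  · rcases mem_statesOf.1 hv with hv | ⟨t, ht, hv⟩
    exacts [hpq hv, hlp t ht hv]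
  · rcases mem_statesOf.1 hv with hv | ⟨t, ht, hv⟩
    exacts [hpq hv.symm, hnq t ht hv]

end Deg

end FA

/-- in a semi-flower automaton with exactly two bpi's `p` and `q`, where the
distance from `q` to `1` is not more than that of `p`, every cycle that visits `p` also visits
`q`; moreover, if `p ≠ q`, the distance from `p` to `1` is strictly greater than that of `q`. -/
theorem cycle_visiting_p_visits_q
    {Q A : Type*} [DecidableEq Q] [DecidableEq A]
    (M : FA Q A) (one p q : Q) (hsf : M.IsSemiFlower one)
    (hpq : p ≠ q) (hp : M.IsBpi p) (hq : M.IsBpi q)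
    (honly : ∀ r, M.IsBpi r → r = p ∨ r = q)
    (hdist : M.dist q one ≤ M.dist p one) :
    (∀ r ts, ts ≠ [] → M.IsPath r ts r → p ∈ FA.statesOf r ts → q ∈ FA.statesOf r ts) ∧
      (p ≠ q → M.dist q one < M.dist p one) := by
  constructor
  · intro r ts hts hcyc hpr
    obtain ⟨k₁, l₁, hl₁, -, hpath₁⟩ := hcyc.exists_append_of_mem_statesOf hpr
    obtain ⟨l₂, k₂, hl₂, hpath₂, -⟩ :=
      hcyc.exists_append_of_mem_statesOf (hsf.cyc r ts hts hcyc)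
    obtain ⟨l, hl, hpath, hne⟩ :=
      (FA.isPath_append_s9.2 ⟨r, hpath₁, hpath₂⟩).exists_subset_not_returning
    obtain ⟨t, ht, htq⟩ := hsf.exists_mem_target_eq hpq hq honly hdist hpath hne
    refine FA.mem_statesOf.2 (Or.inr ⟨t, ?_, htq⟩)
    rcases List.mem_append.1 (hl ht) with h | h
    · exact hl₁ ▸ List.mem_append_right _ h
    · exact hl₂ ▸ List.mem_append_left _ h
  · intro _
    obtain ⟨us, hus⟩ := hsf.exists_isPath_one hp.mem_states
    obtain ⟨l, hl, hlen⟩ := hus.exists_length_eq_dist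
    obtain ⟨t, ht, rfl⟩ := hsf.exists_mem_target_eq hpq hq honly hdist hl fun t ht htp =>
      lt_irrefl _ (htp ▸ hl.dist_lt_of_mem hlen ht)
    exact hl.dist_lt_of_mem hlen ht
end
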